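/- arXiv:1511.02850 — 2 statements merged into one kernel-verified Lean document; each statement's English description precedes it below -/
import Mathlib

section
/- Let A and R be n×n real matrices and a₂, c₂ real numbers, and define the linear endomorphism Φ of pairs of n×n real matrices by Φ(X, Y) = (A X + X Aᵀ + a₂ R Y, (1/2)Y − c₂ R X). If the linear map X ↦ (A + 2a₂c₂ R²) X + X Aᵀ on n×n real matrices has trivial kernel, then Φ is bijective. -/
open Matrix

/-- If the Lyapunov–Sylvester map `X ↦ (A + 2 a₂ c₂ R²) X + X Aᵀ` on n×n real matrices
has trivial kernel, then the linear endomorphism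
`Φ(X, Y) = (A X + X Aᵀ + a₂ R Y, (1/2) Y − c₂ R X)` of pairs of matrices is bijective. -/
theorem phi_bijective_of_trivial_kernel {n : ℕ} (A R : Matrix (Fin n) (Fin n) ℝ)
    (a₂ c₂ : ℝ)
    (hker : ∀ X : Matrix (Fin n) (Fin n) ℝ,
      (A + (2 * a₂ * c₂) • (R * R)) * X + X * Aᵀ = 0 → X = 0) :
    Function.Bijective
      (fun p : Matrix (Fin n) (Fin n) ℝ × Matrix (Fin n) (Fin n) ℝ =>
        (A * p.1 + p.1 * Aᵀ + a₂ • (R * p.2), (1 / 2 : ℝ) • p.2 - c₂ • (R * p.1))) := by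
  let Φ : Matrix (Fin n) (Fin n) ℝ × Matrix (Fin n) (Fin n) ℝ →ₗ[ℝ]
      Matrix (Fin n) (Fin n) ℝ × Matrix (Fin n) (Fin n) ℝ :=
    { toFun := fun p =>
        (A * p.1 + p.1 * Aᵀ + a₂ • (R * p.2), (1 / 2 : ℝ) • p.2 - c₂ • (R * p.1))
      map_add' := fun p q => by
        ext1
        · simp only [Prod.fst_add, Prod.snd_add, mul_add, add_mul, smul_add]
          abel
        · simp only [Prod.fst_add, Prod.snd_add, mul_add, smul_add]
          abel
      map_smul' := fun r p => by
        ext1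
        · simp [smul_add, smul_comm r a₂]
        · simp [smul_sub, smul_comm r c₂, smul_comm r (2⁻¹ : ℝ)] }
  have hinj : Function.Injective Φ := by
    rw [← LinearMap.ker_eq_bot, LinearMap.ker_eq_bot']
    rintro ⟨X, Y⟩ h
    obtain ⟨h₁, h₂⟩ : A * X + X * Aᵀ + a₂ • (R * Y) = 0 ∧
        (1 / 2 : ℝ) • Y - c₂ • (R * X) = 0 := Prod.mk.inj h
    have hY : Y = (2 * c₂) • (R * X) := by
      rw [mul_smul, ← sub_eq_zero.mp h₂, smul_smul]
      norm_num
    have hX : X = 0 := by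
      refine hker X ?_
      rw [← h₁, hY, add_mul, smul_mul_assoc, mul_smul_comm, smul_smul, mul_assoc R R X,
        show a₂ * (2 * c₂) = 2 * a₂ * c₂ by ring]
      abel
    simp [hY, hX]
  exact ⟨hinj, LinearMap.injective_iff_surjective.mp hinj⟩
end

section
/- There exists h₀ ∈ (0, 1) such that for every h ∈ (0, h₀) the following holds: for all (J+1)×(J+1) real matrices D₁ and D₂ there exists a unique pair (U, V) of (J+1)×(J+1) real matrices satisfying A(h) U + U A(h)ᵀ + a₂ R V = D₁ and (1/2)V − c₂ R U = D₂. (Equivalently, the linear endomorphism Φ(X, Y) = (A(h) X + X A(h)ᵀ + a₂ R Y, (1/2)Y − c₂ R X) of pairs of (J+1)×(J+1) real matrices is bijective for all sufficiently small h > 0.) -/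
open Matrix

/-- The (J+1)×(J+1) matrix `A(h)` of the scheme: diagonal `a₁ = 1/2 + 2ασ`,
sub/super-diagonal `a₂ = −ασ` with `σ = h^(2+2s)`, except the entries `(0,1)` and
`(J,J−1)` which equal `2a₂`. -/
noncomputable def Amat (J : ℕ) (α s h : ℝ) : Matrix (Fin (J + 1)) (Fin (J + 1)) ℝ :=
  Matrix.of fun i j : Fin (J + 1) =>
    if (i : ℕ) = (j : ℕ) then 1 / 2 + 2 * α * h ^ ((2 : ℝ) + 2 * s)
    else if ((i : ℕ) = 0 ∧ (j : ℕ) = 1) ∨ ((i : ℕ) = J ∧ (j : ℕ) = J - 1) then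
      2 * (-(α * h ^ ((2 : ℝ) + 2 * s)))
    else if (i : ℕ) + 1 = (j : ℕ) ∨ (j : ℕ) + 1 = (i : ℕ) then
      -(α * h ^ ((2 : ℝ) + 2 * s))
    else 0

/-- The (J+1)×(J+1) matrix `R`: diagonal `−2`, sub/super-diagonal `1`, except the
entries `(0,1)` and `(J,J−1)` which equal `2`. -/
def Rmat (J : ℕ) : Matrix (Fin (J + 1)) (Fin (J + 1)) ℝ :=
  Matrix.of fun i j : Fin (J + 1) =>
    if (i : ℕ) = (j : ℕ) then -2
    else if ((i : ℕ) = 0 ∧ (j : ℕ) = 1) ∨ ((i : ℕ) = J ∧ (j : ℕ) = J - 1) then 2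
    else if (i : ℕ) + 1 = (j : ℕ) ∨ (j : ℕ) + 1 = (i : ℕ) then 1
    else 0

open Filter Topology in
/-- A perturbation of the identity of a finite-dimensional space by two fixed endomorphisms with
coefficients tending to `0` is eventually invertible. -/
theorem eventually_isUnit_one_add_smul_add_smul {ι E : Type*} [AddCommGroup E] [Module ℝ E]
    [FiniteDimensional ℝ E] {l : Filter ι} {a b : ι → ℝ} (ha : Tendsto a l (𝓝 0))
    (hb : Tendsto b l (𝓝 0)) (S T : Module.End ℝ E) :
    ∀ᶠ x in l, IsUnit (1 + a x • S + b x • T) := by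
  classical
  let B := Module.finBasis ℝ E
  let S' := LinearMap.toMatrix B B S
  let T' := LinearMap.toMatrix B B T
  have hc : Continuous fun p : ℝ × ℝ => (1 + p.1 • S' + p.2 • T').det := by fun_prop
  have ht := (hc.tendsto (0, 0)).comp (ha.prodMk_nhds hb)
  have h1 : (1 + (0 : ℝ) • S' + (0 : ℝ) • T').det ≠ 0 := by simp
  filter_upwards [ht.eventually_ne h1] with x hx
  rw [← LinearMap.isUnit_toMatrix_iff B, Matrix.isUnit_iff_isUnit_det, isUnit_iff_ne_zero]
  simpa [S', T', LinearMap.toMatrix_one] using hx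

theorem Amat_eq (J : ℕ) (α s h : ℝ) :
    Amat J α s h = (1 / 2 : ℝ) • (1 : Matrix (Fin (J + 1)) (Fin (J + 1)) ℝ)
      - (α * h ^ ((2 : ℝ) + 2 * s)) • Rmat J := by
  ext i j
  simp only [Amat, Rmat, Matrix.of_apply, Matrix.sub_apply, Matrix.smul_apply, Matrix.one_apply,
    smul_eq_mul, Fin.ext_iff]
  split_ifs <;> ring

/-- If `U ↦ U - c (R U + U Rᵀ) - 2 c d R² U` is invertible, then so is the block system obtained by
adjoining the unknown `V = 2 (D₂ + d R U)`. -/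
theorem existsUnique_block_system {n : Type*} [Fintype n] [DecidableEq n] (A R : Matrix n n ℝ)
    (c d : ℝ) (hA : A = (1 / 2 : ℝ) • (1 : Matrix n n ℝ) - c • R)
    (hU : IsUnit (1 + (-c) • (LinearMap.mulLeft ℝ R + LinearMap.mulRight ℝ Rᵀ)
      + (-(2 * c * d)) • LinearMap.mulLeft ℝ (R * R) : Module.End ℝ (Matrix n n ℝ)))
    (D₁ D₂ : Matrix n n ℝ) :
    ∃! UV : Matrix n n ℝ × Matrix n n ℝ,
      A * UV.1 + UV.1 * Aᵀ + (-c) • (R * UV.2) = D₁ ∧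
        (1 / 2 : ℝ) • UV.2 - d • (R * UV.1) = D₂ := by
  have hV (U V : Matrix n n ℝ) :
      (1 / 2 : ℝ) • V - d • (R * U) = D₂ ↔ V = (2 : ℝ) • D₂ + (2 * d) • (R * U) := by
    constructor
    · rintro rfl
      module
    · rintro rfl
      module
  have hL (U : Matrix n n ℝ) :
      A * U + U * Aᵀ + (-c) • (R * ((2 : ℝ) • D₂ + (2 * d) • (R * U))) = D₁ ↔
        (1 + (-c) • (LinearMap.mulLeft ℝ R + LinearMap.mulRight ℝ Rᵀ)
          + (-(2 * c * d)) • LinearMap.mulLeft ℝ (R * R) : Module.End ℝ (Matrix n n ℝ)) U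
            = D₁ + (2 * c) • (R * D₂) := by
    rw [← sub_eq_zero, ← sub_eq_zero (b := D₁ + _)]
    refine Eq.congr ?_ rfl
    simp only [hA, Matrix.transpose_sub, Matrix.transpose_smul, Matrix.transpose_one, sub_mul,
      mul_sub, mul_add, smul_mul_assoc, mul_smul_comm, one_mul, mul_one, LinearMap.add_apply,
      LinearMap.smul_apply, Module.End.one_apply, LinearMap.mulLeft_apply,
      LinearMap.mulRight_apply, mul_assoc]
    module
  obtain ⟨U, hUeq, hUuniq⟩ :=
    ((Module.End.isUnit_iff _).mp hU).existsUnique (D₁ + (2 * c) • (R * D₂))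
  refine ⟨(U, (2 : ℝ) • D₂ + (2 * d) • (R * U)), ⟨(hL U).mpr hUeq, (hV _ _).mpr rfl⟩, ?_⟩
  rintro ⟨U', V'⟩ ⟨h1, h2⟩
  obtain rfl := (hV U' V').mp h2
  obtain rfl := hUuniq U' ((hL U').mp h1)
  rfl

/-- For all sufficiently small `h ∈ (0, h₀) ⊆ (0,1)`, the discrete system
`A(h) U + U A(h)ᵀ + a₂ R V = D₁`, `(1/2)V − c₂ R U = D₂` (with `a₂ = −α h^(2+2s)`,
`c₂ = α q / h²`) is uniquely solvable for every right-hand side `(D₁, D₂)`. -/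
theorem discrete_system_uniquely_solvable (J : ℕ) (hJ : 4 ≤ J) (α q s : ℝ) (hs : 0 < s) :
    ∃ h₀ : ℝ, 0 < h₀ ∧ h₀ < 1 ∧ ∀ h : ℝ, 0 < h → h < h₀ →
      ∀ D₁ D₂ : Matrix (Fin (J + 1)) (Fin (J + 1)) ℝ,
        ∃! UV : Matrix (Fin (J + 1)) (Fin (J + 1)) ℝ × Matrix (Fin (J + 1)) (Fin (J + 1)) ℝ,
          Amat J α s h * UV.1 + UV.1 * (Amat J α s h)ᵀ
              + (-(α * h ^ ((2 : ℝ) + 2 * s))) • (Rmat J * UV.2) = D₁ ∧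
          (1 / 2 : ℝ) • UV.2 - (α * q / h ^ 2) • (Rmat J * UV.1) = D₂ := by
  have ha : Filter.Tendsto (fun h : ℝ => -(α * h ^ ((2 : ℝ) + 2 * s))) (nhdsWithin 0 (Set.Ioi 0))
      (nhds 0) := by
    have hc : Continuous fun h : ℝ => -(α * h ^ ((2 : ℝ) + 2 * s)) :=
      (continuous_const.mul (Real.continuous_rpow_const (by positivity))).neg
    have h0 := hc.tendsto 0
    rw [Real.zero_rpow (by positivity), mul_zero, neg_zero] at h0
    exact h0.mono_left nhdsWithin_le_nhds
  have hb : Filter.Tendsto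
      (fun h : ℝ => -(2 * (α * h ^ ((2 : ℝ) + 2 * s)) * (α * q / h ^ 2)))
      (nhdsWithin 0 (Set.Ioi 0)) (nhds 0) := by
    have hc : Continuous fun h : ℝ => -(2 * α * α * q * h ^ (2 * s)) :=
      (continuous_const.mul (Real.continuous_rpow_const (by positivity))).neg
    have h0 := hc.tendsto 0
    rw [Real.zero_rpow (by positivity), mul_zero, neg_zero] at h0
    refine (h0.mono_left nhdsWithin_le_nhds).congr' ?_
    filter_upwards [self_mem_nhdsWithin] with h hh
    have hpos : (0 : ℝ) < h := hh
    rw [Real.rpow_add hpos, Real.rpow_two]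
    field_simp
  have hev := eventually_isUnit_one_add_smul_add_smul ha hb
    (LinearMap.mulLeft ℝ (Rmat J) + LinearMap.mulRight ℝ (Rmat J)ᵀ)
    (LinearMap.mulLeft ℝ (Rmat J * Rmat J))
  obtain ⟨u, hu, hsub⟩ := mem_nhdsGT_iff_exists_Ioo_subset.mp hev
  have hu0 : (0 : ℝ) < u := hu
  refine ⟨min u (1 / 2), by positivity, (min_le_right _ _).trans_lt (by norm_num), ?_⟩
  intro h hpos hlt
  exact existsUnique_block_system _ _ _ _ (Amat_eq J α s h)
    (hsub ⟨hpos, hlt.trans_le (min_le_left _ _)⟩)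
end
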